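/- arXiv:0908.1152 — 2 statements merged into one kernel-verified Lean document; each statement's English description precedes it below -/
import Mathlib

section
/- (Abelian Property) Let V ⊆ ℤ^d be finite. If α and β are both legal sequences of topplings for the configuration η that are contained in V and stabilize η in V, then m_α = m_β; in particular Φ_α η = Φ_β η. -/
/-! Diaconis–Fulton representation for Activated Random Walks.

`NatRho` is ℕ ∪ {ρ}, ordered by 0 < ρ < 1 < 2 < ⋯, where `rho` represents one
passive particle. -/

inductive NatRho where
  | nat : ℕ → NatRho
  | rho : NatRho
  deriving DecidableEq

namespace NatRho

/-- Embedding of `NatRho` into ℚ realizing the order 0 < ρ < 1 < 2 < ⋯. -/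
def toVal : NatRho → ℚ
  | nat n => (n : ℚ)
  | rho => 1/2

instance : LE NatRho := ⟨fun a b => a.toVal ≤ b.toVal⟩
instance : LT NatRho := ⟨fun a b => a.toVal < b.toVal⟩

/-- Adding one particle: ρ + 1 = 2. -/
def succ : NatRho → NatRho
  | nat n => nat (n + 1)
  | rho => nat 2

/-- Removing one particle (only ever used when the value is ≥ 1). -/
def pred : NatRho → NatRho
  | nat (n + 1) => nat n
  | a => a

end NatRho

/-- An instruction: `move x y` is τ_{xy}, `sleep x` is τ_{xρ}, `neutral` is ι. -/
inductive Instr (S : Type) where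
  | move : S → S → Instr S
  | sleep : S → Instr S
  | neutral : Instr S
  deriving DecidableEq

/-- `ins.isAt x` : `ins` is an instruction at the site `x`. -/
def Instr.isAt {S : Type} (x : S) : Instr S → Prop
  | .move a b => a = x ∧ b ≠ x
  | .sleep a => a = x
  | .neutral => True

/-- An instruction array `I = (τ^{x,j})`. -/
abbrev InstrArray (S : Type) := S → ℕ → Instr S

/-- Well-formed instruction array: `I x j` is an instruction at `x`. -/
def InstrArray.WF {S : Type} (I : InstrArray S) : Prop := ∀ x j, (I x j).isAt x

variable {S : Type} [DecidableEq S]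

/-- Action of a single instruction on a configuration. -/
def applyInstr (ins : Instr S) (η : S → NatRho) : S → NatRho :=
  match ins with
  | .move x y => fun z => if z = x then (η x).pred else if z = y then (η y).succ else η z
  | .sleep x => fun z => if z = x ∧ η x = .nat 1 then .rho else η z
  | .neutral => η

/-- One toppling step at `x` from the state (configuration, odometer). -/
def step (I : InstrArray S) (st : (S → NatRho) × (S → ℕ)) (x : S) :
    (S → NatRho) × (S → ℕ) :=
  (applyInstr (I x (st.2 x + 1)) st.1, Function.update st.2 x (st.2 x + 1))

/-- Running a sequence of topplings from a given state. -/
def runFrom (I : InstrArray S) (st : (S → NatRho) × (S → ℕ)) (α : List S) :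
    (S → NatRho) × (S → ℕ) :=
  α.foldl (step I) st

/-- A site `x` is unstable in `η` if `η x ≥ 1`. -/
def Unstable (η : S → NatRho) (x : S) : Prop := NatRho.nat 1 ≤ η x

/-- A site `x` is stable in `η` if `η x ∈ {0, ρ}`. -/
def Stable (η : S → NatRho) (x : S) : Prop := ¬ Unstable η x

/-- `α` is a legal sequence of topplings from the state `st`: each toppled site is
unstable at the moment of its toppling. -/
def LegalFrom (I : InstrArray S) : ((S → NatRho) × (S → ℕ)) → List S → Prop
  | _, [] => True
  | st, x :: rest => Unstable st.1 x ∧ LegalFrom I (step I st x) rest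

/-- `α` is a legal sequence of topplings for the configuration `η` (odometer starting
from 0). -/
def Legal (I : InstrArray S) (η : S → NatRho) (α : List S) : Prop :=
  LegalFrom I (η, fun _ => 0) α

/-- `Φ_α η`: the result of the sequence of topplings `α` on `η`. -/
def topple (I : InstrArray S) (η : S → NatRho) (α : List S) : S → NatRho :=
  (runFrom I (η, fun _ => 0) α).1

theorem unstable_iff {S : Type} (η : S → NatRho) (x : S) :
    Unstable η x ↔ ∃ n : ℕ, η x = .nat (n + 1) := by
  unfold Unstable
  change (NatRho.nat 1).toVal ≤ (η x).toVal ↔ _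
  rcases η x with n | _
  · constructor
    · intro h
      have h1 : 1 ≤ n := by simpa [NatRho.toVal] using h
      exact ⟨n - 1, by rw [Nat.sub_add_cancel h1]⟩
    · rintro ⟨m, hm⟩
      rw [hm]
      simp [NatRho.toVal]
  · norm_num [NatRho.toVal]
    exact fun _ => NatRho.noConfusion

/-- An instruction at `x` does not destabilize any other site. -/
theorem unstable_applyInstr_of_ne {ins : Instr S} {η : S → NatRho} {x y : S} (hins : ins.isAt x)
    (hxy : x ≠ y) (hy : Unstable η y) : Unstable (applyInstr ins η) y := by
  rw [unstable_iff] at hy ⊢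
  obtain ⟨n, hn⟩ := hy
  rcases ins with ⟨a, b⟩ | a | _
  · obtain ⟨rfl, -⟩ := hins
    by_cases hb : y = b
    · subst hb
      exact ⟨n + 1, by simp [applyInstr, hxy.symm, hn, NatRho.succ]⟩
    · exact ⟨n, by simp [applyInstr, hxy.symm, hb, hn]⟩
  · obtain rfl : a = x := hins
    exact ⟨n, by simp [applyInstr, hxy.symm, hn]⟩
  · exact ⟨n, hn⟩

/-- Instructions at distinct unstable sites commute. -/
theorem applyInstr_comm {i j : Instr S} {η : S → NatRho} {x y : S} (hi : i.isAt x)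
    (hj : j.isAt y) (hxy : x ≠ y) (hx : Unstable η x) (hy : Unstable η y) :
    applyInstr i (applyInstr j η) = applyInstr j (applyInstr i η) := by
  obtain ⟨m, hm⟩ := (unstable_iff η x).1 hx
  obtain ⟨n, hn⟩ := (unstable_iff η y).1 hy
  funext z
  rcases i with ⟨a, b⟩ | a | _ <;> rcases j with ⟨a', b'⟩ | a' | _ <;>
    simp only [Instr.isAt] at hi hj <;> simp only [applyInstr] <;>
    grind [NatRho.succ, NatRho.pred]

theorem unstable_step_of_ne {I : InstrArray S} (hI : I.WF) {st : (S → NatRho) × (S → ℕ)}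
    {x y : S} (hxy : x ≠ y) (hy : Unstable st.1 y) : Unstable (step I st x).1 y :=
  unstable_applyInstr_of_ne (hI x _) hxy hy

theorem step_comm {I : InstrArray S} (hI : I.WF) {st : (S → NatRho) × (S → ℕ)} {x y : S}
    (hxy : x ≠ y) (hx : Unstable st.1 x) (hy : Unstable st.1 y) :
    step I (step I st x) y = step I (step I st y) x := by
  simp only [step, Function.update_of_ne hxy, Function.update_of_ne hxy.symm]
  exact Prod.ext (applyInstr_comm (hI y _) (hI x _) hxy.symm hy hx)
    (Function.update_comm hxy _ _ _)

/-- A site that is never toppled stays unstable. -/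
theorem unstable_runFrom_of_notMem {I : InstrArray S} (hI : I.WF) {x : S} :
    ∀ {β : List S} {st : (S → NatRho) × (S → ℕ)}, x ∉ β → Unstable st.1 x →
      Unstable (runFrom I st β).1 x
  | [], _, _, h => h
  | y :: β, st, hx, h => by
    rw [List.mem_cons, not_or] at hx
    exact unstable_runFrom_of_notMem hI (st := step I st y) hx.2
      (unstable_step_of_ne hI (Ne.symm hx.1) h)

/-- The first toppling of an unstable site can be moved to the front of a legal sequence. -/
theorem LegalFrom.move_to_front {I : InstrArray S} (hI : I.WF) {x : S} {β₂ : List S} :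
    ∀ {β₁ : List S} {st : (S → NatRho) × (S → ℕ)}, x ∉ β₁ → Unstable st.1 x →
      LegalFrom I st (β₁ ++ x :: β₂) →
      LegalFrom I (step I st x) (β₁ ++ β₂) ∧
        runFrom I st (β₁ ++ x :: β₂) = runFrom I (step I st x) (β₁ ++ β₂)
  | [], _, _, _, hl => ⟨hl.2, rfl⟩
  | y :: β₁, st, hx, h, hl => by
    rw [List.mem_cons, not_or] at hx
    obtain ⟨hy, hl⟩ := hl
    obtain ⟨h₁, h₂⟩ := LegalFrom.move_to_front hI hx.2
      (unstable_step_of_ne hI (Ne.symm hx.1) h) hl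
    rw [← step_comm hI hx.1 h hy] at h₁ h₂
    exact ⟨⟨unstable_step_of_ne hI hx.1 hy, h₁⟩, h₂⟩

/-- Two legal stabilizing sequences from the same state are permutations of each other and
lead to the same state. -/
theorem LegalFrom.perm_and_runFrom_eq {I : InstrArray S} (hI : I.WF) {V : Set S} :
    ∀ {α β : List S} {st : (S → NatRho) × (S → ℕ)}, LegalFrom I st α → LegalFrom I st β →
      (∀ y ∈ α, y ∈ V) → (∀ y ∈ β, y ∈ V) →
      (∀ y ∈ V, Stable (runFrom I st α).1 y) → (∀ y ∈ V, Stable (runFrom I st β).1 y) →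
      α.Perm β ∧ runFrom I st α = runFrom I st β
  | [], [], _, _, _, _, _, _, _ => ⟨.nil, rfl⟩
  | [], y :: _, _, _, hβ, _, hβV, hsα, _ =>
    absurd hβ.1 (hsα y (hβV y List.mem_cons_self))
  | x :: α, β, st, hα, hβ, hαV, hβV, hsα, hsβ => by
    have hxβ : x ∈ β := by
      by_contra hx
      exact hsβ x (hαV x List.mem_cons_self) (unstable_runFrom_of_notMem hI hx hα.1)
    obtain ⟨β₁, β₂, rfl, hx⟩ := List.eq_append_cons_of_mem hxβ
    obtain ⟨hl, hr⟩ := LegalFrom.move_to_front hI hx hα.1 hβ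
    rw [hr] at hsβ ⊢
    obtain ⟨hp, he⟩ := LegalFrom.perm_and_runFrom_eq hI hα.2 hl
      (fun y hy => hαV y (List.mem_cons_of_mem _ hy))
      (fun y hy => hβV y (by simp only [List.mem_append, List.mem_cons] at hy ⊢; tauto))
      hsα hsβ
    exact ⟨(hp.cons x).trans List.perm_middle.symm, he⟩

/-- Abelian Property: two legal sequences of topplings contained in
the finite set `V` which both stabilize `η` in `V` have equal odometers, and in
particular yield the same final configuration. -/
theorem arw_abelian_property
    {d : ℕ} (hd : 1 ≤ d) (I : InstrArray (Fin d → ℤ)) (hI : I.WF)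
    (η : (Fin d → ℤ) → NatRho) (V : Finset (Fin d → ℤ)) (α β : List (Fin d → ℤ))
    (hα : Legal I η α) (hβ : Legal I η β)
    (hαV : ∀ y ∈ α, y ∈ V) (hβV : ∀ y ∈ β, y ∈ V)
    (hstabα : ∀ y ∈ V, Stable (topple I η α) y)
    (hstabβ : ∀ y ∈ V, Stable (topple I η β) y) :
    (∀ x, α.count x = β.count x) ∧ topple I η α = topple I η β := by
  obtain ⟨hp, he⟩ := LegalFrom.perm_and_runFrom_eq (V := (V : Set (Fin d → ℤ))) hI hα hβ
    hαV hβV hstabα hstabβ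
  exact ⟨fun x => hp.count_eq x, congrArg Prod.fst he⟩
end

section
/- (Monotonicity with enforced activation) Let I and Ĩ be instruction arrays with Ĩ ≥ I, let η be a configuration and let V ⊆ ℤ^d be finite. If some sequence contained in V is legal for η under Ĩ and stabilizes η in V, then some sequence contained in V is legal for η under I and stabilizes η in V, and m_V(x; η, I) ≤ m_V(x; η, Ĩ) for every x ∈ ℤ^d. -/
variable {S : Type} [DecidableEq S]

/-- `I' ≥ I`: each instruction either coincides, or a sleep instruction of `I` is
replaced in `I'` by the neutral instruction. -/
def InstrArray.Ge {S : Type} (I' I : InstrArray S) : Prop :=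
  ∀ x j, I' x j = I x j ∨ (I x j = Instr.sleep x ∧ I' x j = Instr.neutral)

namespace NatRho

/-- Number of particles, active or passive. -/
def count : NatRho → ℕ
  | nat n => n
  | rho => 1

lemma nat_one_le_iff (a : NatRho) : nat 1 ≤ a ↔ ∃ n, a = nat (n + 1) := by
  change (nat 1).toVal ≤ a.toVal ↔ _
  rcases a with (_ | n) | _
  · norm_num [toVal]
  · simp [toVal]
  · simp only [reduceCtorEq, exists_false, iff_false]
    norm_num [toVal]

lemma count_succ (a : NatRho) : a.succ.count = a.count + 1 := by
  cases a <;> rfl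

end NatRho

/-- Number of particles that have left `x` after `k` topplings of `x`. -/
def outflow (I : InstrArray S) (x : S) (k : ℕ) : ℕ :=
  Nat.count (fun j => I x (j + 1) ≠ .sleep x ∧ I x (j + 1) ≠ .neutral) k

/-- Number of particles that sites of `V`, toppled according to the odometer `h`, have
sent to `x`. -/
def inflow (I : InstrArray S) (V : Finset S) (h : S → ℕ) (x : S) : ℕ :=
  ∑ y ∈ V, Nat.count (fun j => I y (j + 1) = .move y x) (h y)

lemma outflow_succ (I : InstrArray S) (x : S) (k : ℕ) :
    outflow I x (k + 1) = outflow I x k +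
      if I x (k + 1) ≠ .sleep x ∧ I x (k + 1) ≠ .neutral then 1 else 0 :=
  Nat.count_succ _ _

lemma inflow_mono (I : InstrArray S) (V : Finset S) {h k : S → ℕ} (hk : ∀ x, h x ≤ k x)
    (x : S) : inflow I V h x ≤ inflow I V k x :=
  Finset.sum_le_sum fun y _ => Nat.count_monotone _ (hk y)

lemma inflow_update (I : InstrArray S) {V : Finset S} (h : S → ℕ) {y : S} (hy : y ∈ V)
    (x : S) : inflow I V (Function.update h y (h y + 1)) x =
      inflow I V h x + if I y (h y + 1) = .move y x then 1 else 0 := by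
  unfold inflow
  rw [← Finset.add_sum_erase _ _ hy, ← Finset.add_sum_erase V _ hy, Function.update_self,
    Nat.count_succ]
  have : ∀ z ∈ V.erase y,
      Nat.count (fun j => I z (j + 1) = .move z x) (Function.update h y (h y + 1) z) =
        Nat.count (fun j => I z (j + 1) = .move z x) (h z) := fun z hz => by
    rw [Function.update_of_ne (Finset.ne_of_mem_erase hz)]
  rw [Finset.sum_congr rfl this]
  omega

lemma InstrArray.Ge.move_iff {S : Type} {I I' : InstrArray S} (hge : I'.Ge I) (x y : S) (j : ℕ) :
    I' x j = .move x y ↔ I x j = .move x y := by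
  rcases hge x j with h | ⟨h, h'⟩ <;> simp [*]

lemma InstrArray.Ge.inflow_eq {I I' : InstrArray S} (hge : I'.Ge I) (V : Finset S)
    (h : S → ℕ) (x : S) : inflow I' V h x = inflow I V h x := by
  simp only [inflow, hge.move_iff]

lemma InstrArray.Ge.outflow_eq {I I' : InstrArray S} (hge : I'.Ge I) (x : S) (k : ℕ) :
    outflow I' x k = outflow I x k := by
  have : ∀ j, (I' x j ≠ .sleep x ∧ I' x j ≠ .neutral) ↔
      (I x j ≠ .sleep x ∧ I x j ≠ .neutral) := fun j => by
    rcases hge x j with h | ⟨h, h'⟩ <;> simp [*]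
  simp only [outflow, this]

/-- The last instruction used at `x` is a sleep instruction or, if there is none, `x` holds
a passive particle initially. -/
def LastSleep (I : InstrArray S) (η : S → NatRho) (h : S → ℕ) (x : S) : Prop :=
  (h x = 0 ∧ η x = .rho) ∨ (0 < h x ∧ I x (h x) = .sleep x)

lemma InstrArray.Ge.lastSleep {S : Type} {I I' : InstrArray S}
    (hge : I'.Ge I) {η : S → NatRho} {h k : S → ℕ} {x : S} (hk : k x = h x)
    (hs : LastSleep I' η h x) :
    LastSleep I η k x := by
  unfold LastSleep at *
  rw [hk]
  rcases hge x (h x) with e | ⟨e, e'⟩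
  · rwa [← e]
  · simpa [e, e'] using hs.imp_right And.left

/-- Facts preserved by legal topplings in `V`: the particle balance at each site, and the
determination of passive particles by the odometer. -/
structure Reachable (I : InstrArray S) (V : Finset S) (η : S → NatRho)
    (st : (S → NatRho) × (S → ℕ)) : Prop where
  balance : ∀ x, (st.1 x).count + outflow I x (st.2 x) = (η x).count + inflow I V st.2 x
  lastSleep : ∀ x, st.1 x = .rho → LastSleep I η st.2 x
  rho_or : ∀ x, LastSleep I η st.2 x → st.1 x = .rho ∨ ∃ n, st.1 x = .nat (n + 2)

lemma Reachable.initial (I : InstrArray S) (V : Finset S) (η : S → NatRho) :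
    Reachable I V η (η, fun _ => 0) where
  balance x := by simp [outflow, inflow]
  lastSleep x h := .inl ⟨rfl, h⟩
  rho_or x h := by simpa [LastSleep] using h.elim (fun h => .inl h.2) (by simp)

lemma Reachable.step {I : InstrArray S} (hI : I.WF) {V : Finset S} {η : S → NatRho}
    {st : (S → NatRho) × (S → ℕ)} (hst : Reachable I V η st) {y : S} (hy : y ∈ V)
    (hu : Unstable st.1 y) : Reachable I V η (step I st y) := by
  obtain ⟨ξ, h⟩ := st
  obtain ⟨n, hn⟩ := (NatRho.nat_one_le_iff _).1 hu
  obtain ⟨hb, hl, hr⟩ := hst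
  have hwf := hI y (h y + 1)
  simp only at hb hl hr hn
  refine ⟨fun z => ?_, fun z => ?_, fun z => ?_⟩
  · have hbz := hb z
    simp only [_root_.step, inflow_update I h hy]
    rcases eq_or_ne z y with rfl | hz
    · rw [Function.update_self, outflow_succ]
      rw [hn] at hbz
      rcases hi : I z (h z + 1) with ⟨a, b⟩ | a | _ <;> rw [hi] at hwf
      · obtain ⟨rfl, hne⟩ := hwf
        simp [applyInstr, hn, NatRho.pred, NatRho.count, hne] at hbz ⊢
        omega
      · obtain rfl := hwf
        by_cases h0 : n = 0 <;> simp [applyInstr, hn, NatRho.count, h0] at hbz ⊢ <;> omega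
      · simp [applyInstr, hn, NatRho.count] at hbz ⊢
        omega
    · rw [Function.update_of_ne hz]
      rcases hi : I y (h y + 1) with ⟨a, b⟩ | a | _ <;> rw [hi] at hwf
      · obtain ⟨rfl, hne⟩ := hwf
        by_cases hzb : z = b
        · subst hzb
          simp [applyInstr, hz, NatRho.count_succ]
          omega
        · simpa [applyInstr, hz, hzb, Ne.symm hzb] using hbz
      · obtain rfl := hwf
        simpa [applyInstr, hz] using hbz
      · simpa [applyInstr] using hbz
  all_goals
    have hlz := hl z
    have hrz := hr z
    simp only [_root_.step, LastSleep] at hlz hrz ⊢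
    rcases eq_or_ne z y with rfl | hz
    · rw [Function.update_self]
      rcases hi : I z (h z + 1) with ⟨a, b⟩ | a | _ <;> rw [hi] at hwf
      · obtain ⟨rfl, hne⟩ := hwf
        simp [applyInstr, hn, NatRho.pred]
      · obtain rfl := hwf
        rcases n with _ | n <;> simp [applyInstr, hn]
      · simp [applyInstr, hn]
    · rw [Function.update_of_ne hz]
      rcases hi : I y (h y + 1) with ⟨a, b⟩ | a | _ <;> rw [hi] at hwf
      · obtain ⟨rfl, hne⟩ := hwf
        by_cases hzb : z = b
        · subst hzb
          simp only [applyInstr, if_neg hz, if_true]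
          rcases hξ : ξ z with m | _
          · simp only [hξ, NatRho.succ] at hrz ⊢
            first
              | simp; done
              | intro hs
                obtain ⟨k, hk⟩ := (hrz hs).resolve_left (by simp)
                exact .inr ⟨k + 1, by simpa using hk⟩
          · simp [NatRho.succ]
        · simpa [applyInstr, hz, hzb] using by assumption
      · obtain rfl := hwf
        simpa [applyInstr, hz] using by assumption
      · simpa [applyInstr] using by assumption

lemma Reachable.runFrom {I : InstrArray S} (hI : I.WF) {V : Finset S} {η : S → NatRho}
    (α : List S) {st : (S → NatRho) × (S → ℕ)} (hst : Reachable I V η st)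
    (hα : ∀ y ∈ α, y ∈ V) (hleg : LegalFrom I st α) : Reachable I V η (runFrom I st α) := by
  induction α generalizing st with
  | nil => exact hst
  | cons x α ih =>
    exact ih (hst.step hI (hα x (by simp)) hleg.1) (fun y hy => hα y (by simp [hy])) hleg.2

lemma runFrom_snd (I : InstrArray S) (α : List S) (st : (S → NatRho) × (S → ℕ)) (x : S) :
    (runFrom I st α).2 x = st.2 x + α.count x := by
  induction α generalizing st with
  | nil => simp [runFrom]
  | cons y α ih =>
    change (runFrom I (step I st y) α).2 x = _
    rw [ih, List.count_cons]
    rcases eq_or_ne x y with rfl | hne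
    · simp [step]; omega
    · simp [step, hne, hne.symm]

lemma LegalFrom.concat {I : InstrArray S} {x : S} (β : List S)
    {st : (S → NatRho) × (S → ℕ)} (hβ : LegalFrom I st β)
    (hx : Unstable (runFrom I st β).1 x) : LegalFrom I st (β ++ [x]) := by
  induction β generalizing st with
  | nil => exact ⟨hx, trivial⟩
  | cons y β ih => exact ⟨hβ.1, ih hβ.2 hx⟩

/-- If `β`, legal under `I`, has used no site more often than `α`, legal under `I' ≥ I`,
and `α` leaves `x` stable while `β` leaves it unstable, then `β` has used `x` strictly less. -/
lemma count_lt_of_unstable {I I' : InstrArray S} (hI : I.WF) (hI' : I'.WF) (hge : I'.Ge I)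
    {η : S → NatRho} {V : Finset S} {α β : List S}
    (hαV : ∀ y ∈ α, y ∈ V) (hα : Legal I' η α) (hβV : ∀ y ∈ β, y ∈ V) (hβ : Legal I η β)
    (hle : ∀ x, β.count x ≤ α.count x) {x : S}
    (hs : Stable (topple I' η α) x) (hu : Unstable (topple I η β) x) :
    β.count x < α.count x := by
  refine lt_of_le_of_ne (hle x) fun heq => hs ?_
  have hrα := (Reachable.initial I' V η).runFrom hI' α hαV hα
  have hrβ := (Reachable.initial I V η).runFrom hI β hβV hβ
  have h2α : (runFrom I' (η, fun _ => 0) α).2 = fun x => α.count x :=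
    funext fun x => by simp [runFrom_snd]
  have h2β : (runFrom I (η, fun _ => 0) β).2 = fun x => β.count x :=
    funext fun x => by simp [runFrom_snd]
  have bα := hrα.balance x
  have bβ := hrβ.balance x
  rw [h2α, hge.inflow_eq, hge.outflow_eq] at bα
  rw [h2β] at bβ
  have hin := inflow_mono I V hle x
  obtain ⟨n, hn⟩ := (NatRho.nat_one_le_iff _).1 hu
  rw [topple] at hn
  rw [hn] at bβ
  simp only [heq, NatRho.count] at bα bβ
  refine (NatRho.nat_one_le_iff _).2 ?_
  rw [topple]
  rcases hξ : (runFrom I' (η, fun _ => 0) α).1 x with (_ | m) | _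
  · simp [hξ] at bα
    omega
  · exact ⟨m, rfl⟩
  · have hsl : LastSleep I η (runFrom I (η, fun _ => 0) β).2 x :=
      hge.lastSleep (by simp only [h2α, h2β, heq]) (hrα.lastSleep x hξ)
    rcases hrβ.rho_or x hsl with h | ⟨k, h⟩
    · simp [hn] at h
    · simp [hn] at h
      simp [hξ] at bα
      omega

/-- Monotonicity with enforced activation: if `Ĩ ≥ I` and `η` can be
stabilized in `V` by a sequence contained in `V` which is legal under `Ĩ`, then it can
also be so stabilized under `I`, and `m_V(x; η, I) ≤ m_V(x; η, Ĩ)` for all `x`. -/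
theorem arw_monotonicity_enforced_activation
    {d : ℕ} (hd : 1 ≤ d) (I I' : InstrArray (Fin d → ℤ)) (hI : I.WF) (hI' : I'.WF)
    (hge : I'.Ge I)
    (η : (Fin d → ℤ) → NatRho) (V : Finset (Fin d → ℤ)) (α : List (Fin d → ℤ))
    (hαV : ∀ y ∈ α, y ∈ V) (hα : Legal I' η α)
    (hstabα : ∀ y ∈ V, Stable (topple I' η α) y) :
    ∃ β : List (Fin d → ℤ), (∀ y ∈ β, y ∈ V) ∧ Legal I η β ∧
      (∀ y ∈ V, Stable (topple I η β) y) ∧ ∀ x, β.count x ≤ α.count x := by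
  by_contra hne
  push Not at hne
  have key : ∀ n, ∃ β : List (Fin d → ℤ), β.length = n ∧ (∀ y ∈ β, y ∈ V) ∧ Legal I η β ∧
      ∀ x, β.count x ≤ α.count x := by
    intro n
    induction n with
    | zero => exact ⟨[], rfl, by simp, trivial, by simp⟩
    | succ n ih =>
      obtain ⟨β, hlen, hβV, hβ, hle⟩ := ih
      have hns : ¬ ∀ y ∈ V, Stable (topple I η β) y := fun hs =>
        (hne β hβV hβ hs).elim fun x hx => (hle x).not_gt hx
      simp only [Stable, not_forall, not_not] at hns
      obtain ⟨x, hxV, hu⟩ := hns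
      have hlt := count_lt_of_unstable hI hI' hge hαV hα hβV hβ hle (hstabα x hxV) hu
      refine ⟨β ++ [x], by simp [hlen], ?_, LegalFrom.concat β hβ hu, fun z => ?_⟩
      · intro y hy
        rcases List.mem_append.1 hy with hy | hy
        · exact hβV y hy
        · rwa [List.mem_singleton.1 hy]
      · rw [List.count_append]
        rcases eq_or_ne z x with rfl | hz
        · simpa using hlt
        · simpa [hz.symm] using hle z
  obtain ⟨β, hlen, -, -, hle⟩ := key (α.length + 1)
  have := (List.subperm_ext_iff.2 fun x _ => hle x).length_le
  omega
end
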